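/- arXiv:2503.20562 — 3 statements merged into one kernel-verified Lean document; each statement's English description precedes it below -/
import Mathlib

section
/- Let D be a division ring with center F, and let σ be an anti-automorphism of D over F such that σ^i ≠ id for all 1 ≤ i ≤ m. If D satisfies a σ^m-generalized polynomial identity of degree n, then D satisfies a σ^m-generalized polynomial identity which is blended σ^m-linear of degree not exceeding n. -/
/-! Core: the ring of generalized polynomials `D⟨ι⟩ = D *_F F⟨ι⟩`,
constructed as a quotient of the free algebra on `D ⊕ ι`. -/

variable (F D : Type*) [Field F] [DivisionRing D] [Algebra F D]

/-- The relations presenting the free product `D *_F F⟨ι⟩` as a quotient of the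
free `F`-algebra on the disjoint union of (the underlying set of) `D` and the
set `ι` of noncommuting indeterminates. -/
inductive GPRel (ι : Type*) :
    FreeAlgebra F (D ⊕ ι) → FreeAlgebra F (D ⊕ ι) → Prop
  | add (a b : D) : GPRel ι (FreeAlgebra.ι F (Sum.inl (a + b)))
      (FreeAlgebra.ι F (Sum.inl a) + FreeAlgebra.ι F (Sum.inl b))
  | mul (a b : D) : GPRel ι (FreeAlgebra.ι F (Sum.inl (a * b)))
      (FreeAlgebra.ι F (Sum.inl a) * FreeAlgebra.ι F (Sum.inl b))
  | central (α : F) : GPRel ι (FreeAlgebra.ι F (Sum.inl (algebraMap F D α)))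
      (algebraMap F (FreeAlgebra F (D ⊕ ι)) α)

/-- The ring `D⟨ι⟩ = D *_F F⟨ι⟩` of generalized polynomials over `D` in the
noncommuting indeterminates `ι`. -/
def GP (ι : Type*) : Type _ := RingQuot (GPRel F D ι)

noncomputable instance (ι : Type*) : Ring (GP F D ι) :=
  inferInstanceAs (Ring (RingQuot (GPRel F D ι)))

noncomputable instance (ι : Type*) : Algebra F (GP F D ι) :=
  inferInstanceAs (Algebra F (RingQuot (GPRel F D ι)))

variable {F D}

/-- The indeterminate `x_i` as a generalized polynomial. -/
noncomputable def GP.X {ι : Type*} (i : ι) : GP F D ι :=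
  RingQuot.mkAlgHom F (GPRel F D ι) (FreeAlgebra.ι F (Sum.inr i))

/-- The canonical embedding of `D` into `D⟨ι⟩`. -/
noncomputable def GP.C {ι : Type*} : D →ₐ[F] GP F D ι where
  toFun d := RingQuot.mkAlgHom F (GPRel F D ι) (FreeAlgebra.ι F (Sum.inl d))
  map_one' := by
    show RingQuot.mkAlgHom F (GPRel F D ι) (FreeAlgebra.ι F (Sum.inl (1 : D))) = 1
    rw [show (1 : D) = algebraMap F D 1 by simp,
      RingQuot.mkAlgHom_rel F (GPRel.central 1)]
    simp
  map_mul' a b := by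
    show RingQuot.mkAlgHom F (GPRel F D ι) (FreeAlgebra.ι F (Sum.inl (a * b))) = _ * _
    rw [RingQuot.mkAlgHom_rel F (GPRel.mul a b), map_mul]
  map_zero' := by
    show RingQuot.mkAlgHom F (GPRel F D ι) (FreeAlgebra.ι F (Sum.inl (0 : D))) = 0
    rw [show (0 : D) = algebraMap F D 0 by simp,
      RingQuot.mkAlgHom_rel F (GPRel.central 0)]
    simp
  map_add' a b := by
    show RingQuot.mkAlgHom F (GPRel F D ι) (FreeAlgebra.ι F (Sum.inl (a + b))) = _ + _
    rw [RingQuot.mkAlgHom_rel F (GPRel.add a b), map_add]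
  commutes' α := by
    show RingQuot.mkAlgHom F (GPRel F D ι)
      (FreeAlgebra.ι F (Sum.inl (algebraMap F D α))) = _
    rw [RingQuot.mkAlgHom_rel F (GPRel.central α)]
    simp
    rfl

/-- The universal property of `D⟨ι⟩`: an `F`-algebra map on `D` together with an
assignment of values to the indeterminates induces an `F`-algebra map on `D⟨ι⟩`. -/
noncomputable def GP.lift {ι A : Type*} [Semiring A] [Algebra F A]
    (φ : D →ₐ[F] A) (v : ι → A) : GP F D ι →ₐ[F] A :=
  RingQuot.liftAlgHom F ⟨FreeAlgebra.lift F (Sum.elim φ v), by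
    intro x y h
    cases h with
    | add a b => simp
    | mul a b => simp
    | central α => simp⟩

/-- Evaluation of a generalized polynomial at a point of `Dⁿ`: the unique
`F`-algebra map `D⟨ι⟩ → D` restricting to the identity on `D` and sending each
indeterminate `x_i` to `v i`. -/
noncomputable def GP.eval {ι : Type*} (v : ι → D) : GP F D ι →ₐ[F] D :=
  GP.lift (AlgHom.id F D) v

/-- The `F`-algebra endomorphism of `D⟨X_m⟩` that is the identity on `D`, sends
`x_j^{σ^i}` to `0` for all `0 ≤ i ≤ m`, and fixes all other indeterminates. -/
noncomputable def GP.killVar {F D : Type*} [Field F] [DivisionRing D] [Algebra F D]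
    {n m : ℕ} (j : Fin n) :
    GP F D (Fin n × Fin (m + 1)) →ₐ[F] GP F D (Fin n × Fin (m + 1)) :=
  GP.lift GP.C (fun p => if p.1 = j then 0 else GP.X p)

/-- `f ∈ D⟨X_m⟩` is blended if it is blended with respect to every indeterminate
occurring in it: for each `j`, either `x_j` does not occur in `f` (killing the
copies of `x_j` fixes `f`) or killing the copies of `x_j` sends `f` to `0`. -/
def GP.Blended {F D : Type*} [Field F] [DivisionRing D] [Algebra F D]
    {n m : ℕ} (f : GP F D (Fin n × Fin (m + 1))) : Prop :=
  ∀ j : Fin n, GP.killVar j f = f ∨ GP.killVar j f = 0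

/-- The submodule of generalized polynomials of degree at most `k`: the `F`-span
of the products `d₀ z₁ d₁ z₂ ⋯ z_l d_l` with `dₜ ∈ D`, `zₜ` indeterminates and
`l ≤ k`. -/
noncomputable def GP.degLE {F D : Type*} [Field F] [DivisionRing D] [Algebra F D]
    {ι : Type*} (k : ℕ) : Submodule F (GP F D ι) :=
  Submodule.span F {x : GP F D ι | ∃ l : ℕ, l ≤ k ∧ ∃ (d : Fin (l + 1) → D) (z : Fin l → ι),
    x = (List.ofFn fun i : Fin l => GP.C (d i.castSucc) * GP.X (z i)).prod
      * GP.C (d (Fin.last l))}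

/-- The embedding of `D⟨X_m⟩` into the generalized polynomial ring on the doubled
set of indeterminates `x_j^{σ^i}, y_j^{σ^i}` (the `y`'s are fresh). -/
noncomputable def GP.doubleEmb {F D : Type*} [Field F] [DivisionRing D] [Algebra F D]
    {n m : ℕ} :
    GP F D (Fin n × Fin (m + 1)) →ₐ[F] GP F D ((Fin n ⊕ Fin n) × Fin (m + 1)) :=
  GP.lift GP.C (fun p => GP.X (Sum.inl p.1, p.2))

/-- The substitution `x_j^{σ^i} ↦ x_j^{σ^i} + y_j^{σ^i}` (for all `0 ≤ i ≤ m`),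
fixing `D` and all other indeterminates. -/
noncomputable def GP.addSubst {F D : Type*} [Field F] [DivisionRing D] [Algebra F D]
    {n m : ℕ} (j : Fin n) :
    GP F D ((Fin n ⊕ Fin n) × Fin (m + 1)) →ₐ[F] GP F D ((Fin n ⊕ Fin n) × Fin (m + 1)) :=
  GP.lift GP.C (fun p => if p.1 = Sum.inl j then GP.X p + GP.X (Sum.inr j, p.2) else GP.X p)

/-- The substitution `x_j^{σ^i} ↦ y_j^{σ^i}` (for all `0 ≤ i ≤ m`), fixing `D`
and all other indeterminates. -/
noncomputable def GP.swapSubst {F D : Type*} [Field F] [DivisionRing D] [Algebra F D]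
    {n m : ℕ} (j : Fin n) :
    GP F D ((Fin n ⊕ Fin n) × Fin (m + 1)) →ₐ[F] GP F D ((Fin n ⊕ Fin n) × Fin (m + 1)) :=
  GP.lift GP.C (fun p => if p.1 = Sum.inl j then GP.X (Sum.inr j, p.2) else GP.X p)

/-- `f` is `σ^m`-linear: `f` is blended and, for each indeterminate `x_j`
occurring in `f`, the substitution `x_j^{σ^i} ↦ x_j^{σ^i} + y_j^{σ^i}` (with
`y_j` a fresh indeterminate) sends `f` to `f + f|_{x_j ↦ y_j}`. -/
def GP.SigmaLinear {F D : Type*} [Field F] [DivisionRing D] [Algebra F D]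
    {n m : ℕ} (f : GP F D (Fin n × Fin (m + 1))) : Prop :=
  GP.Blended f ∧ ∀ j : Fin n, GP.killVar j f = f ∨
    GP.addSubst j (GP.doubleEmb f) = GP.doubleEmb f + GP.swapSubst j (GP.doubleEmb f)

namespace GP

section Basic

variable {F D : Type*} [Field F] [DivisionRing D] [Algebra F D] {ι κ A : Type*}
  [Semiring A] [Algebra F A]

@[simp]
theorem lift_X (φ : D →ₐ[F] A) (v : ι → A) (i : ι) : lift φ v (X i) = v i := by
  unfold lift X
  erw [RingQuot.liftAlgHom_mkAlgHom_apply]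
  simp

@[simp]
theorem lift_C (φ : D →ₐ[F] A) (v : ι → A) (d : D) : lift φ v (C d) = φ d := by
  unfold lift C
  erw [RingQuot.liftAlgHom_mkAlgHom_apply]
  simp

theorem algHom_ext {φ ψ : GP F D ι →ₐ[F] A} (hC : ∀ d, φ (C d) = ψ (C d))
    (hX : ∀ i, φ (X i) = ψ (X i)) : φ = ψ := by
  refine RingQuot.ringQuot_ext' F φ ψ (FreeAlgebra.hom_ext ?_)
  funext s
  cases s with
  | inl d => exact hC d
  | inr i => exact hX i

theorem lift_lift (φ : D →ₐ[F] A) (w : κ → A) (v : ι → GP F D κ) (f : GP F D ι) :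
    lift φ w (lift C v f) = lift φ (fun i => lift φ w (v i)) f := by
  have h : (lift φ w).comp (lift C v) = lift φ (fun i => lift φ w (v i)) :=
    algHom_ext (by simp) (by simp)
  exact DFunLike.congr_fun h f

theorem lift_X_eq_self (f : GP F D ι) : lift C X f = f := by
  have h : lift C X = AlgHom.id F (GP F D ι) := algHom_ext (by simp) (by simp)
  exact DFunLike.congr_fun h f

/-- The generalized monomial `d₁ z₁ ⋯ d_l z_l d`, where `L = [(d₁, z₁), …, (d_l, z_l)]`. -/
noncomputable def monomial (L : List (D × ι)) (d : D) : GP F D ι :=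
  (L.map fun a => C a.1 * X a.2).prod * C d

theorem monomial_cons (a : D × ι) (L : List (D × ι)) (d : D) :
    monomial (F := F) (a :: L) d = C a.1 * X a.2 * monomial L d := by
  simp [monomial, mul_assoc]

theorem degLE_eq_span_monomial (k : ℕ) :
    degLE k = Submodule.span F
      {x : GP F D ι | ∃ L : List (D × ι), L.length ≤ k ∧ ∃ d, x = monomial L d} := by
  unfold degLE
  congr 1
  ext x
  constructor
  · rintro ⟨l, hl, d, z, rfl⟩
    refine ⟨List.ofFn fun i : Fin l => (d i.castSucc, z i), by simpa using hl, d (Fin.last l), ?_⟩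
    simp [monomial, List.map_ofFn, Function.comp_def]
  · rintro ⟨L, hL, d, rfl⟩
    refine ⟨L.length, hL, Fin.snoc (fun i => (L.get i).1) d, fun i => (L.get i).2, ?_⟩
    simp only [Fin.snoc_castSucc, Fin.snoc_last, monomial]
    congr 2
    conv_lhs => rw [← List.ofFn_get L, List.map_ofFn]
    rfl

theorem monomial_mem_degLE {k : ℕ} {L : List (D × ι)} (hL : L.length ≤ k) (d : D) :
    monomial L d ∈ (degLE k : Submodule F (GP F D ι)) := by
  rw [degLE_eq_span_monomial]
  exact Submodule.subset_span ⟨L, hL, d, rfl⟩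

theorem degLE_mono {k l : ℕ} (h : k ≤ l) : (degLE k : Submodule F (GP F D ι)) ≤ degLE l :=
  Submodule.span_mono fun _ ⟨i, hi, hx⟩ => ⟨i, hi.trans h, hx⟩

theorem C_mem_degLE (k : ℕ) (d : D) : C d ∈ (degLE k : Submodule F (GP F D ι)) := by
  simpa [monomial] using monomial_mem_degLE (F := F) (L := ([] : List (D × ι))) (Nat.zero_le k) d

theorem X_mem_degLE_one (i : ι) : X i ∈ (degLE 1 : Submodule F (GP F D ι)) := by
  simpa [monomial] using
    monomial_mem_degLE (F := F) (k := 1) (L := [((1 : D), i)]) (by simp) 1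

theorem mul_mem_degLE {k l : ℕ} {f g : GP F D ι} (hf : f ∈ degLE k) (hg : g ∈ degLE l) :
    f * g ∈ degLE (k + l) := by
  have hle : (degLE k : Submodule F (GP F D ι)) * degLE l ≤ degLE (k + l) := by
    rw [degLE_eq_span_monomial k, degLE_eq_span_monomial l, Submodule.span_mul_span,
      Submodule.span_le]
    rintro _ ⟨_, ⟨L, hL, d, rfl⟩, _, ⟨M, hM, e, rfl⟩, rfl⟩
    cases M with
    | nil =>
      have : monomial L d * monomial [] e = monomial (F := F) L (d * e) := by
        simp [monomial, mul_assoc]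
      simp only [this]
      exact monomial_mem_degLE (by omega) _
    | cons a M =>
      have : monomial L d * monomial (a :: M) e
          = monomial (F := F) (L ++ (d * a.1, a.2) :: M) e := by
        simp [monomial, mul_assoc]
      simp only [this]
      refine monomial_mem_degLE ?_ _
      simp only [List.length_append, List.length_cons] at hM ⊢
      omega
  exact hle (Submodule.mul_mem_mul hf hg)

theorem lift_mem_degLE {k : ℕ} {v : ι → GP F D κ} (hv : ∀ i, v i ∈ degLE 1) {f : GP F D ι}
    (hf : f ∈ degLE k) : lift C v f ∈ degLE k := by
  have hmon (L : List (D × ι)) (d : D) : lift C v (monomial L d) ∈ degLE L.length := by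
    induction L with
    | nil => simpa [monomial] using C_mem_degLE 0 d
    | cons a L ih =>
      rw [monomial_cons, map_mul, map_mul, lift_C, lift_X]
      have h := mul_mem_degLE (mul_mem_degLE (C_mem_degLE 0 a.1) (hv a.2)) ih
      exact degLE_mono (by simp; omega) h
  have hle : (degLE k : Submodule F (GP F D ι)) ≤ (degLE k).comap (lift C v).toLinearMap := by
    rw [degLE_eq_span_monomial k, Submodule.span_le]
    rintro _ ⟨L, hL, d, rfl⟩
    exact degLE_mono hL (hmon L d)
  exact hle hf

end Basic

section Kill

variable {F D : Type*} [Field F] [DivisionRing D] [Algebra F D] {m : ℕ} {κ : Type*}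
  [DecidableEq κ]

/-- Substitute `0` for all the copies `x_j^{σ^i}` of `x_j`, for an arbitrary index type. -/
noncomputable def kill (j : κ) : GP F D (κ × Fin (m + 1)) →ₐ[F] GP F D (κ × Fin (m + 1)) :=
  lift C (fun p => if p.1 = j then 0 else X p)

theorem killVar_eq_kill {n : ℕ} (j : Fin n) :
    (killVar j : GP F D (Fin n × Fin (m + 1)) →ₐ[F] _) = kill j := rfl

theorem kill_idem (j : κ) (f : GP F D (κ × Fin (m + 1))) : kill j (kill j f) = kill j f := by
  unfold kill
  rw [lift_lift]
  congr 2
  funext p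
  split_ifs with h <;> simp [h]

theorem kill_comm (i j : κ) (f : GP F D (κ × Fin (m + 1))) :
    kill i (kill j f) = kill j (kill i f) := by
  unfold kill
  rw [lift_lift, lift_lift]
  congr 2
  funext p
  rw [apply_ite (lift C _), apply_ite (lift C _), lift_X, lift_X, map_zero, map_zero]
  split_ifs <;> rfl

theorem kill_mem_degLE {k : ℕ} (j : κ) {f : GP F D (κ × Fin (m + 1))} (hf : f ∈ degLE k) :
    kill j f ∈ degLE k := by
  refine lift_mem_degLE (fun p => ?_) hf
  split_ifs
  exacts [zero_mem _, X_mem_degLE_one p]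

theorem kill_monomial (j : κ) (L : List (D × (κ × Fin (m + 1)))) (d : D) :
    kill j (monomial (F := F) L d)
      = if j ∈ L.map (fun a => a.2.1) then 0 else monomial L d := by
  induction L with
  | nil => simp [monomial, kill]
  | cons a L ih =>
    rw [monomial_cons, map_mul, map_mul, ih]
    by_cases h : a.2.1 = j
    · simp [kill, h]
    · have h' : j ≠ a.2.1 := fun e => h e.symm
      simp only [kill, lift_C, lift_X, if_neg h, List.map_cons, List.mem_cons, h', false_or]
      split_ifs <;> simp

theorem mem_span_monomial_of_kill_eq_zero {k : ℕ} {f : GP F D (κ × Fin (m + 1))}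
    (hf : f ∈ degLE k) (S : Finset κ) (hS : ∀ j ∈ S, kill j f = 0) :
    f ∈ Submodule.span F {x | ∃ L : List (D × (κ × Fin (m + 1))), L.length ≤ k ∧
      (∀ j ∈ S, j ∈ L.map (fun a => a.2.1)) ∧ ∃ d, x = monomial L d} := by
  induction S using Finset.induction_on with
  | empty => simpa [degLE_eq_span_monomial] using hf
  | insert j S _ ih =>
    replace ih := ih fun i hi => hS i (Finset.mem_insert_of_mem hi)
    let Q : GP F D (κ × Fin (m + 1)) →ₗ[F] GP F D (κ × Fin (m + 1)) :=
      LinearMap.id - (kill j).toLinearMap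
    have hfj : Q f = f := by
      simp [Q, hS j (Finset.mem_insert_self j S)]
    rw [← hfj]
    rw [← Submodule.mem_comap]
    refine Submodule.span_le.2 ?_ ih
    rintro _ ⟨L, hL, hLS, d, rfl⟩
    simp only [SetLike.mem_coe, Submodule.mem_comap, Q, LinearMap.sub_apply, LinearMap.id_apply,
      AlgHom.toLinearMap_apply, kill_monomial]
    split_ifs with h
    · rw [sub_zero]
      exact Submodule.subset_span ⟨L, hL, by simpa using ⟨by simpa using h, by simpa using hLS⟩,
        d, rfl⟩
    · rw [sub_self]
      exact zero_mem _

theorem card_le_of_kill_eq_zero {k : ℕ} {f : GP F D (κ × Fin (m + 1))} (hf0 : f ≠ 0)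
    (hf : f ∈ degLE k) (S : Finset κ) (hS : ∀ j ∈ S, kill j f = 0) : S.card ≤ k := by
  by_contra! hlt
  apply hf0
  have h := mem_span_monomial_of_kill_eq_zero hf S hS
  rw [← Submodule.mem_bot F]
  refine Submodule.span_le.2 ?_ h
  rintro _ ⟨L, hL, hLS, -⟩
  have hsub : S ⊆ (L.map fun a => a.2.1).toFinset := fun j hj => by
    simpa using hLS j hj
  have h1 := Finset.card_le_card hsub
  have h2 := (L.map fun a => a.2.1).toFinset_card_le
  rw [List.length_map] at h2
  omega

end Kill

section Identity

variable {F D : Type*} [Field F] [DivisionRing D] [Algebra F D] {m : ℕ} {κ κ' : Type*}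
  {σ : D → D} {n : ℕ}

/-- `f` has degree at most `n` and vanishes under the evaluations `x_j^{σ^i} ↦ σ^i(r_j)`. -/
structure IsIdentity (σ : D → D) (n : ℕ) (f : GP F D (κ × Fin (m + 1))) : Prop where
  mem_degLE : f ∈ degLE n
  eval_eq_zero (r : κ → D) : eval (fun p => σ^[(p.2 : ℕ)] (r p.1)) f = 0

namespace IsIdentity

/-- Stability of identities under substitutions compatible with evaluation. -/
theorem lift {f : GP F D (κ × Fin (m + 1))} (hf : IsIdentity σ n f)
    {v : κ × Fin (m + 1) → GP F D (κ' × Fin (m + 1))} (hv : ∀ p, v p ∈ degLE 1)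
    (t : (κ' → D) → κ → D)
    (ht : ∀ r p, eval (fun q => σ^[(q.2 : ℕ)] (r q.1)) (v p) = σ^[(p.2 : ℕ)] (t r p.1)) :
    IsIdentity σ n (GP.lift C v f) where
  mem_degLE := lift_mem_degLE hv hf.mem_degLE
  eval_eq_zero r := by
    rw [← hf.eval_eq_zero (t r)]
    unfold eval
    rw [lift_lift]
    congr 2
    funext p
    exact ht r p

theorem sub {f g : GP F D (κ × Fin (m + 1))} (hf : IsIdentity σ n f) (hg : IsIdentity σ n g) :
    IsIdentity σ n (f - g) where
  mem_degLE := sub_mem hf.mem_degLE hg.mem_degLE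
  eval_eq_zero r := by rw [map_sub, hf.eval_eq_zero, hg.eval_eq_zero, sub_zero]

end IsIdentity

/-- Renaming of the indeterminates. -/
noncomputable def rename (e : κ ≃ κ') : GP F D (κ × Fin (m + 1)) →ₐ[F] GP F D (κ' × Fin (m + 1)) :=
  lift C (fun p => X (e p.1, p.2))

theorem rename_ne_zero (e : κ ≃ κ') {f : GP F D (κ × Fin (m + 1))} (hf : f ≠ 0) :
    rename e f ≠ 0 := by
  intro h
  apply hf
  have h' : rename e.symm (rename e f) = f := by
    unfold rename
    rw [lift_lift]
    simpa using lift_X_eq_self f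
  rw [← h', h, map_zero]

theorem IsIdentity.rename {f : GP F D (κ × Fin (m + 1))} (hf : IsIdentity σ n f) (e : κ ≃ κ') :
    IsIdentity σ n (rename e f) :=
  hf.lift (fun _ => X_mem_degLE_one _) (fun r => r ∘ e) (by simp [eval])

variable [DecidableEq κ] [DecidableEq κ']

namespace IsIdentity

theorem kill (hσ : ∀ i, σ^[i] 0 = 0) {f : GP F D (κ × Fin (m + 1))} (hf : IsIdentity σ n f)
    (j : κ) : IsIdentity σ n (kill j f) := by
  refine hf.lift (fun p => ?_) (fun r => Function.update r j 0) fun r p => ?_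
  · split_ifs
    exacts [zero_mem _, X_mem_degLE_one p]
  · by_cases h : p.1 = j
    · simp [h, hσ]
    · simp [h, eval]

theorem exists_blended (hσ : ∀ i, σ^[i] 0 = 0) {f : GP F D (κ × Fin (m + 1))} (hf0 : f ≠ 0)
    (hf : IsIdentity σ n f) (T : Finset κ) :
    ∃ g : GP F D (κ × Fin (m + 1)), g ≠ 0 ∧ IsIdentity σ n g ∧
      ∀ j ∈ T, GP.kill j g = g ∨ GP.kill j g = 0 := by
  induction T using Finset.induction_on with
  | empty => exact ⟨f, hf0, hf, by simp⟩
  | insert a T _ ih =>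
    obtain ⟨g, hg0, hg, hgT⟩ := ih
    by_cases h : GP.kill a g = 0
    · refine ⟨g, hg0, hg, fun j hj => ?_⟩
      rcases Finset.mem_insert.1 hj with rfl | hj
      exacts [Or.inr h, hgT j hj]
    · refine ⟨GP.kill a g, h, hg.kill hσ a, fun j hj => ?_⟩
      rcases Finset.mem_insert.1 hj with rfl | hj
      · exact Or.inl (kill_idem _ _)
      · rw [kill_comm]
        rcases hgT j hj with e | e
        · exact Or.inl (by rw [e])
        · exact Or.inr (by rw [e, map_zero])

end IsIdentity

theorem kill_rename (e : κ ≃ κ') (j : κ) (f : GP F D (κ × Fin (m + 1))) :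
    kill (e j) (rename e f) = rename e (kill j f) := by
  unfold kill rename
  rw [lift_lift, lift_lift]
  congr 2
  funext p
  by_cases h : p.1 = j <;> simp [h]

/-- The partial linearization `f(x_j + y_j) - f(x_j) - f(y_j)`. -/
noncomputable def polarize {N : ℕ} (j : Fin N) (f : GP F D (Fin N × Fin (m + 1))) :
    GP F D ((Fin N ⊕ Fin N) × Fin (m + 1)) :=
  addSubst j (doubleEmb f) - doubleEmb f - swapSubst j (doubleEmb f)

theorem addSubst_doubleEmb {N : ℕ} (j : Fin N) (f : GP F D (Fin N × Fin (m + 1))) :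
    addSubst j (doubleEmb f) = lift C (fun p => if p.1 = j then
      X (Sum.inl p.1, p.2) + X (Sum.inr j, p.2) else X (Sum.inl p.1, p.2)) f := by
  unfold addSubst doubleEmb
  rw [lift_lift]
  simp

theorem swapSubst_doubleEmb {N : ℕ} (j : Fin N) (f : GP F D (Fin N × Fin (m + 1))) :
    swapSubst j (doubleEmb f) = lift C (fun p => if p.1 = j then
      X (Sum.inr j, p.2) else X (Sum.inl p.1, p.2)) f := by
  unfold swapSubst doubleEmb
  rw [lift_lift]
  simp

theorem IsIdentity.polarize {N : ℕ} {f : GP F D (Fin N × Fin (m + 1))}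
    (hσ : ∀ i a b, σ^[i] (a + b) = σ^[i] a + σ^[i] b) (hf : IsIdentity σ n f) (j : Fin N) :
    IsIdentity σ n (polarize j f) := by
  unfold GP.polarize
  rw [addSubst_doubleEmb, swapSubst_doubleEmb]
  refine ((hf.lift (fun p => ?_)
    (fun r i => if i = j then r (Sum.inl i) + r (Sum.inr j) else r (Sum.inl i))
    fun r p => ?_).sub
    (hf.lift (fun p => X_mem_degLE_one _) (fun r i => r (Sum.inl i)) fun r p => ?_)).sub
    (hf.lift (fun p => ?_)
    (fun r i => if i = j then r (Sum.inr j) else r (Sum.inl i)) fun r p => ?_)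
  · split_ifs
    exacts [add_mem (X_mem_degLE_one _) (X_mem_degLE_one _), X_mem_degLE_one _]
  · split_ifs <;> simp [eval, hσ]
  · simp [eval]
  · split_ifs <;> exact X_mem_degLE_one _
  · split_ifs <;> simp [eval]

theorem kill_polarize_inl_of_ne {N : ℕ} {i j : Fin N} (hij : i ≠ j)
    (f : GP F D (Fin N × Fin (m + 1))) :
    kill (Sum.inl i) (polarize j f) = polarize j (kill i f) := by
  unfold polarize
  rw [map_sub, map_sub, addSubst_doubleEmb, swapSubst_doubleEmb, addSubst_doubleEmb,
    swapSubst_doubleEmb]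
  unfold kill doubleEmb
  simp only [lift_lift]
  congr 3
  all_goals
    congr 1
    funext p
    by_cases h : p.1 = j
    · simp [h, hij.symm]
    · by_cases h' : p.1 = i <;> simp [h, h', hij]

theorem kill_polarize_inr_of_ne {N : ℕ} {i j : Fin N} (hij : i ≠ j)
    (f : GP F D (Fin N × Fin (m + 1))) :
    kill (Sum.inr i) (polarize j f) = polarize j f := by
  unfold polarize
  rw [map_sub, map_sub, addSubst_doubleEmb, swapSubst_doubleEmb]
  unfold kill doubleEmb
  simp only [lift_lift]
  congr 3
  all_goals
    congr 1
    funext p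
    by_cases h : p.1 = j <;> simp [h, hij.symm]

theorem kill_polarize_inl_self {N : ℕ} {j : Fin N} {f : GP F D (Fin N × Fin (m + 1))}
    (hf : kill j f = 0) : kill (Sum.inl j) (polarize j f) = 0 := by
  have h1 : kill (Sum.inl j) (addSubst j (doubleEmb f)) = swapSubst j (doubleEmb f) := by
    rw [addSubst_doubleEmb, swapSubst_doubleEmb, kill, lift_lift]
    congr 2
    funext p
    by_cases h : p.1 = j <;> simp [h]
  have h2 : kill (Sum.inl j) (doubleEmb f) = doubleEmb (kill j f) := by
    unfold kill doubleEmb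
    rw [lift_lift, lift_lift]
    congr 2
    funext p
    by_cases h : p.1 = j <;> simp [h]
  have h3 : kill (Sum.inl j) (swapSubst j (doubleEmb f)) = swapSubst j (doubleEmb f) := by
    rw [swapSubst_doubleEmb, kill, lift_lift]
    congr 2
    funext p
    by_cases h : p.1 = j <;> simp [h]
  rw [polarize, map_sub, map_sub, h1, h2, h3, hf, map_zero, sub_zero, sub_self]

theorem kill_polarize_inr_self {N : ℕ} {j : Fin N} {f : GP F D (Fin N × Fin (m + 1))}
    (hf : kill j f = 0) : kill (Sum.inr j) (polarize j f) = 0 := by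
  have h1 : kill (Sum.inr j) (addSubst j (doubleEmb f)) = doubleEmb f := by
    rw [addSubst_doubleEmb, kill, lift_lift, doubleEmb]
    congr 2
    funext p
    by_cases h : p.1 = j <;> simp [h]
  have h2 : kill (Sum.inr j) (doubleEmb f) = doubleEmb f := by
    rw [kill, doubleEmb, lift_lift]
    congr 2
    funext p
    simp
  have h3 : kill (Sum.inr j) (swapSubst j (doubleEmb f)) = doubleEmb (kill j f) := by
    rw [swapSubst_doubleEmb, kill, lift_lift, doubleEmb, kill, lift_lift]
    congr 2
    funext p
    by_cases h : p.1 = j <;> simp [h]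
  rw [polarize, map_sub, map_sub, h1, h2, h3, hf, map_zero, sub_zero, sub_self]

theorem IsIdentity.exists_sigmaLinear (hσ : ∀ i a b, σ^[i] (a + b) = σ^[i] a + σ^[i] b) {N : ℕ}
    {f : GP F D (Fin N × Fin (m + 1))} (hf0 : f ≠ 0) (hf : IsIdentity σ n f) (S : Finset (Fin N))
    (hS : ∀ j ∈ S, GP.kill j f = 0) (hS' : ∀ j ∉ S, GP.kill j f = f) :
    ∃ (N' : ℕ) (g : GP F D (Fin N' × Fin (m + 1))), g ≠ 0 ∧ IsIdentity σ n g ∧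
      SigmaLinear g := by
  by_cases hlin : ∃ j ∈ S, GP.polarize j f ≠ 0
  · obtain ⟨j, hj, hj0⟩ := hlin
    let e : Fin N ⊕ Fin N ≃ Fin (N + N) := finSumFinEquiv
    have hcard := card_le_of_kill_eq_zero hf0 hf.mem_degLE S hS
    have hcard' : ((S.disjSum {j}).map e.toEmbedding).card = S.card + 1 := by simp
    refine exists_sigmaLinear hσ (rename_ne_zero e hj0) ((hf.polarize hσ j).rename e)
      ((S.disjSum {j}).map e.toEmbedding) (fun q hq => ?_) (fun q hq => ?_)
    all_goals
      obtain ⟨s, rfl⟩ := e.surjective q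
      rw [kill_rename]
      have hs : e s ∈ (S.disjSum {j}).map e.toEmbedding ↔ s ∈ S.disjSum {j} := by simp
      rw [hs] at hq
      rcases s with i | i
      all_goals
        simp only [Finset.inl_mem_disjSum, Finset.inr_mem_disjSum, Finset.mem_singleton] at hq
    · by_cases hij : i = j
      · rw [hij, kill_polarize_inl_self (hS j hj), map_zero]
      · rw [kill_polarize_inl_of_ne hij, hS i hq]
        simp [GP.polarize]
    · rw [hq, kill_polarize_inr_self (hS j hj), map_zero]
    · rw [kill_polarize_inl_of_ne (by rintro rfl; exact hq hj), hS' i hq]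
    · rw [kill_polarize_inr_of_ne hq]
  · push Not at hlin
    refine ⟨N, f, hf0, hf, fun j => ?_, fun j => ?_⟩
    all_goals
      rw [killVar_eq_kill]
      by_cases hj : j ∈ S
    · exact Or.inr (hS j hj)
    · exact Or.inl (hS' j hj)
    · have h := hlin j hj
      rw [GP.polarize, sub_sub, sub_eq_zero] at h
      exact Or.inr h
    · exact Or.inl (hS' j hj)
termination_by n + 1 - S.card
decreasing_by
  rw [hcard']
  omega

end Identity

end GP

/-- Let `D` be a division ring with center `F`, and let `σ` be an
anti-automorphism of `D` over `F` such that `σ^i ≠ id` for all `1 ≤ i ≤ m`.  If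
`D` satisfies a `σ^m`-generalized polynomial identity of degree `n`, then `D`
satisfies a `σ^m`-generalized polynomial identity which is blended `σ^m`-linear of
degree not exceeding `n`. -/
theorem stmt2 {D : Type*} [DivisionRing D] (F : Type*) [Field F] [Algebra F D]
    (hcen : Set.range (algebraMap F D) = (Subring.center D : Set D))
    (σ : D → D) (hσbij : Function.Bijective σ)
    (hσadd : ∀ a b : D, σ (a + b) = σ a + σ b)
    (hσmul : ∀ a b : D, σ (a * b) = σ b * σ a)
    (hσF : ∀ α : F, σ (algebraMap F D α) = algebraMap F D α)
    (m : ℕ) (hm : 1 ≤ m)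
    (hσord : ∀ i : ℕ, 1 ≤ i → i ≤ m → σ^[i] ≠ id)
    (N n : ℕ) (f : GP F D (Fin N × Fin (m + 1))) (hf : f ≠ 0)
    (hdeg : f ∈ GP.degLE n)
    (hGPI : ∀ r : Fin N → D,
      GP.eval (fun p : Fin N × Fin (m + 1) => σ^[(p.2 : ℕ)] (r p.1)) f = 0) :
    ∃ (N' : ℕ) (g : GP F D (Fin N' × Fin (m + 1))), g ≠ 0 ∧
      (∀ r : Fin N' → D,
        GP.eval (fun p : Fin N' × Fin (m + 1) => σ^[(p.2 : ℕ)] (r p.1)) g = 0) ∧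
      GP.SigmaLinear g ∧ g ∈ GP.degLE n := by
  have hadd : ∀ i a b, σ^[i] (a + b) = σ^[i] a + σ^[i] b := fun i a b => by
    simpa using iterate_map_add (AddMonoidHom.mk' σ hσadd) i a b
  have hzero : ∀ i, σ^[i] 0 = 0 := fun i => by
    simpa using iterate_map_zero (AddMonoidHom.mk' σ hσadd) i
  obtain ⟨g, hg0, hg, hgT⟩ :=
    GP.IsIdentity.exists_blended hzero hf ⟨hdeg, hGPI⟩ Finset.univ
  classical
  obtain ⟨N', h, h0, hid, hlin⟩ := hg.exists_sigmaLinear hadd hg0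
    (Finset.univ.filter fun j => GP.kill j g = 0) (by simp)
    (fun j hj => (hgT j (Finset.mem_univ j)).resolve_right (by simpa using hj))
  exact ⟨N', h, h0, hid.eval_eq_zero, hlin, hid.mem_degLE⟩
end

section
/- Let D be a division ring with center F, and suppose F is infinite. Then the following assertions are equivalent: (1) D is centrally finite; (2) D satisfies a polynomial identity; (3) D satisfies a generalized polynomial identity. -/
/-! Core: the ring of generalized polynomials `D⟨ι⟩ = D *_F F⟨ι⟩`,
constructed as a quotient of the free algebra on `D ⊕ ι`. -/

variable (F D : Type*) [Field F] [DivisionRing D] [Algebra F D]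

variable {F D}

theorem eq_zero_of_sum_smul_basis_eq_zero {F D I A : Type*} [Field F] [AddCommGroup D]
    [Module F D] (b : Module.Basis I F D) (S : Finset A) (g : A → I) (hg : Set.InjOn g S)
    (c : A → F) (h : ∑ l ∈ S, c l • b (g l) = 0) : ∀ l ∈ S, c l = 0 := by
  have : LinearIndepOn F (fun l => b (g l)) (S : Set A) :=
    b.linearIndependent.comp (fun l : (S : Set A) => g l) (Set.injOn_iff_injective.mp hg)
  exact linearIndepOn_finset_iff.mp this c h

theorem coeff_eq_zero_of_finite_rank
    (hcen : Set.range (algebraMap F D) = (Subring.center D : Set D))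
    (hD : ¬ FiniteDimensional F D) {I : Type*} {b : I → D} (hb : LinearIndependent F b)
    (s : Finset I) (a : I → D) (W : Submodule F D) [FiniteDimensional F W]
    (h : ∀ x, ∑ i ∈ s, a i * x * b i ∈ W) : ∀ i ∈ s, a i = 0 := by
  classical
  induction s using Finset.induction_on generalizing a W with
  | empty => simp
  | insert i₀ s hi₀ ih =>
    by_cases h0 : a i₀ = 0
    · have := ih a W (fun x => by simpa [Finset.sum_insert hi₀, h0] using h x)
      simpa [h0] using this
    · exfalso
      have hcomm : ∀ y, ∀ i ∈ s, y * ((a i₀)⁻¹ * a i) - (a i₀)⁻¹ * a i * y = 0 := by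
        intro y
        refine ih _ (W.map (LinearMap.mulLeft F (y * (a i₀)⁻¹)) ⊔
          W.map (LinearMap.mulLeft F (a i₀)⁻¹)) fun x => ?_
        have h1 := Submodule.mem_map_of_mem (f := LinearMap.mulLeft F (y * (a i₀)⁻¹)) (h x)
        have h2 := Submodule.mem_map_of_mem (f := LinearMap.mulLeft F (a i₀)⁻¹) (h (y * x))
        convert Submodule.sub_mem _ (Submodule.mem_sup_left h1) (Submodule.mem_sup_right h2)
          using 1
        simp only [LinearMap.mulLeft_apply, Finset.sum_insert hi₀, mul_add, Finset.mul_sum]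
        rw [show y * (a i₀)⁻¹ * (a i₀ * x * b i₀) = (a i₀)⁻¹ * (a i₀ * (y * x) * b i₀) by
          simp [mul_assoc, h0], add_sub_add_left_eq_sub, ← Finset.sum_sub_distrib]
        exact Finset.sum_congr rfl fun i _ => by noncomm_ring
      have hscal : ∀ i, ∃ r : F, i ∈ s → algebraMap F D r = (a i₀)⁻¹ * a i := by
        intro i
        by_cases hi : i ∈ s
        · have : (a i₀)⁻¹ * a i ∈ Set.range (algebraMap F D) := by
            rw [hcen]
            exact Subring.mem_center_iff.mpr fun y => sub_eq_zero.mp (hcomm y i hi)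
          exact this.imp fun r hr _ => hr
        · exact ⟨0, fun h => absurd h hi⟩
      choose r hr using hscal
      set e : D := b i₀ + ∑ i ∈ s, r i • b i with he
      have he0 : e ≠ 0 := by
        intro hz
        have := linearIndependent_iff'.mp hb (insert i₀ s) (fun i => if i = i₀ then 1 else r i)
          (by
            rw [Finset.sum_insert hi₀, ← hz, he]
            simp only [if_true, one_smul]
            congr 1
            refine Finset.sum_congr rfl fun i hi => ?_
            rw [if_neg (ne_of_mem_of_not_mem hi hi₀)]) i₀ (Finset.mem_insert_self _ _)
        simp at this
      have hT : ∀ x, ∑ i ∈ insert i₀ s, a i * x * b i = a i₀ * x * e := by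
        intro x
        rw [Finset.sum_insert hi₀, he, mul_add, Finset.mul_sum]
        congr 1
        refine Finset.sum_congr rfl fun i hi => ?_
        have : a i = a i₀ * algebraMap F D (r i) := by rw [hr i hi, mul_inv_cancel_left₀ h0]
        rw [this, Algebra.smul_def, mul_assoc (a i₀), Algebra.commutes]
        simp only [mul_assoc]
      apply hD
      have htop : W = ⊤ := by
        rw [eq_top_iff]
        rintro y -
        have := h ((a i₀)⁻¹ * y * e⁻¹)
        rwa [hT, show a i₀ * ((a i₀)⁻¹ * y * e⁻¹) * e = y by
          simp [mul_assoc, h0, he0]] at this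
      subst htop
      exact Module.Finite.equiv Submodule.topEquiv

section Words

variable {I J : Type*}

/-- The value at `v` of the word `X_{j₁} b_{i₁} X_{j₂} b_{i₂} ⋯`. -/
def wordEval (b : I → D) (v : J → D) (l : List (J × I)) : D :=
  (l.map fun z => v z.1 * b z.2).prod

theorem wordEval_nil (b : I → D) (v : J → D) : wordEval b v [] = 1 := rfl

theorem wordEval_cons (b : I → D) (v : J → D) (z : J × I) (l : List (J × I)) :
    wordEval b v (z :: l) = v z.1 * b z.2 * wordEval b v l := by
  simp [wordEval]

theorem wordEval_append (b : I → D) (v : J → D) (l m : List (J × I)) :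
    wordEval b v (l ++ m) = wordEval b v l * wordEval b v m := by
  simp [wordEval]

theorem wordEval_update [DecidableEq J] (b : I → D) (v : J → D) (j : J) (x : D)
    (l : List (J × I)) (hl : j ∉ l.map Prod.fst) :
    wordEval b (Function.update v j x) l = wordEval b v l := by
  unfold wordEval
  congr 1
  refine List.map_congr_left fun z hz => ?_
  rw [Function.update_of_ne]
  rintro rfl
  exact hl (List.mem_map_of_mem hz)

/-- Substituting `x` for `X_j` in `m₁ X_h b_k X_j b_i m₂`. -/
theorem linearCombination_wordEval_mapDomain [DecidableEq J] (b : Module.Basis I F D) (v : J → D)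
    (j : J) (x : D) (m₁ m₂ : List (J × I)) (h : J) (i' i : I) (hm₁ : j ∉ m₁.map Prod.fst)
    (hh : h ≠ j) (hm₂ : j ∉ m₂.map Prod.fst) :
    Finsupp.linearCombination F (wordEval b v)
      ((b.repr (b i' * x * b i)).mapDomain fun k => m₁ ++ (h, k) :: m₂) =
    wordEval b (Function.update v j x) (m₁ ++ (h, i') :: (j, i) :: m₂) := by
  rw [Finsupp.linearCombination_mapDomain]
  have : (wordEval b v ∘ fun k => m₁ ++ (h, k) :: m₂) =
      (LinearMap.mulLeft F (wordEval b v m₁ * v h) ∘ₗ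
        LinearMap.mulRight F (wordEval b v m₂)) ∘ b := by
    ext k
    simp [wordEval_append, wordEval_cons, mul_assoc]
  rw [this, ← Finsupp.apply_linearCombination, b.linearCombination_repr]
  simp [wordEval_append, wordEval_cons, wordEval_update, hm₁, hm₂, hh, mul_assoc]

theorem append_cons_inj_of_notMem {m₁ m₂ n₁ n₂ : List (J × I)} {h h' : J} {k k' : I}
    (hm₁ : k ∉ m₁.map Prod.snd) (hn₁ : k ∉ n₁.map Prod.snd) (hn₂ : k ∉ n₂.map Prod.snd)
    (e : n₁ ++ (h', k') :: n₂ = m₁ ++ (h, k) :: m₂) : n₁ = m₁ ∧ h' = h ∧ n₂ = m₂ := by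
  induction m₁ generalizing n₁ with
  | nil =>
    cases n₁ with
    | nil => simp_all
    | cons z n₁ => simp_all
  | cons y m₁ ih =>
    cases n₁ with
    | nil =>
      simp only [List.nil_append, List.cons_append, List.cons.injEq] at e
      exact absurd (by simp [e.2]) hn₂
    | cons z n₁ =>
      simp only [List.map_cons, List.mem_cons, not_or] at hm₁ hn₁
      simp only [List.cons_append, List.cons.injEq] at e
      obtain ⟨h1, h2, h3⟩ := ih hm₁.2 hn₁.2 e.2
      exact ⟨by rw [e.1, h1], h2, h3⟩

theorem exists_split_of_perm {t₀ j : J} {s l' : List J} (hs : (t₀ :: j :: s).Nodup)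
    {l : List (J × I)} (hl : l.map Prod.fst = t₀ :: l') (hperm : l'.Perm (j :: s)) :
    ∃ (m₁ m₂ : List (J × I)) (h : J) (i' i : I), l = m₁ ++ (h, i') :: (j, i) :: m₂ ∧
      j ∉ m₁.map Prod.fst ∧ h ≠ j ∧ j ∉ m₂.map Prod.fst := by
  have hnd : (l.map Prod.fst).Nodup := by
    rw [hl]; exact (hperm.cons t₀).nodup_iff.mpr hs
  have hj : j ∈ l.map Prod.fst := by
    rw [hl]; exact List.mem_cons_of_mem _ (hperm.mem_iff.mpr List.mem_cons_self)
  obtain ⟨⟨j', i⟩, hz, rfl⟩ := List.mem_map.mp hj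
  obtain ⟨m, m₂, rfl⟩ := List.append_of_mem hz
  rcases List.eq_nil_or_concat' m with rfl | ⟨m₁, ⟨h, i'⟩, rfl⟩
  · simp only [List.nil_append, List.map_cons, List.cons.injEq] at hl
    simp [hl.1] at hs
  · refine ⟨m₁, m₂, h, i', i, by simp, ?_⟩
    simp only [List.map_append, List.map_cons, List.append_assoc,
      List.cons_append, List.nil_append, List.nodup_append, List.nodup_cons] at hnd
    refine ⟨fun hm => hnd.2.2 _ hm _ (by simp) rfl, fun e => hnd.2.1.1 (by simp [e]),
      hnd.2.1.2.1⟩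

theorem perm_of_split {t₀ j h : J} {s r₁ r₂ l' : List J}
    (hl : r₁ ++ h :: j :: r₂ = t₀ :: l') (hperm : l'.Perm (j :: s)) :
    ∃ l'', r₁ ++ h :: r₂ = t₀ :: l'' ∧ l''.Perm s := by
  cases r₁ with
  | nil =>
    simp only [List.nil_append, List.cons.injEq] at hl
    obtain ⟨rfl, rfl⟩ := hl
    exact ⟨r₂, rfl, hperm.cons_inv⟩
  | cons c r₁ =>
    simp only [List.cons_append, List.cons.injEq] at hl
    obtain ⟨rfl, rfl⟩ := hl
    refine ⟨_, rfl, List.Perm.cons_inv (a := j) (.trans ?_ hperm)⟩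
    have : r₁ ++ h :: j :: r₂ = (r₁ ++ [h]) ++ j :: r₂ := by simp
    rw [this]
    refine .trans ?_ List.perm_middle.symm
    simp

theorem eq_zero_of_multilinear
    (hcen : Set.range (algebraMap F D) = (Subring.center D : Set D))
    (hD : ¬ FiniteDimensional F D) (b : Module.Basis I F D) (t₀ : J) (s : List J)
    (hs : (t₀ :: s).Nodup) (p : List (J × I) →₀ F)
    (hp : ∀ l ∈ p.support, ∃ l', l.map Prod.fst = t₀ :: l' ∧ l'.Perm s)
    (h : ∀ v : J → D, Finsupp.linearCombination F (wordEval b v) p = 0) : p = 0 := by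
  classical
  have : Nonempty I := b.index_nonempty
  induction s generalizing p with
  | nil =>
    have hp' : ∀ l, ∃ i, l ∈ p.support → l = [(t₀, i)] := by
      intro l
      by_cases hl : l ∈ p.support
      · obtain ⟨l', h1, h2⟩ := hp l hl
        rw [List.perm_nil.mp h2, List.map_eq_singleton_iff] at h1
        obtain ⟨⟨t, i⟩, rfl, rfl⟩ := h1
        exact ⟨i, fun _ => rfl⟩
      · exact ⟨Classical.arbitrary I, fun h => absurd h hl⟩
    choose g hg using hp'
    by_contra hne
    obtain ⟨l, hl⟩ := Finsupp.support_nonempty_iff.mpr hne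
    refine Finsupp.mem_support_iff.mp hl (eq_zero_of_sum_smul_basis_eq_zero b p.support g
      (fun l hl m hm e => by rw [hg l hl, hg m hm, e]) p ?_ l hl)
    rw [← h fun _ => 1, Finsupp.linearCombination_apply, Finsupp.sum]
    refine Finset.sum_congr rfl fun l hl => ?_
    have := congrArg (wordEval b fun _ : J => (1 : D)) (hg l hl)
    rw [this]
    simp [wordEval]
  | cons j s ih =>
    have hsplit : ∀ l, ∃ q : (List (J × I) × J × List (J × I)) × I × I, l ∈ p.support →
        l = q.1.1 ++ (q.1.2.1, q.2.1) :: (j, q.2.2) :: q.1.2.2 ∧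
        j ∉ q.1.1.map Prod.fst ∧ q.1.2.1 ≠ j ∧ j ∉ q.1.2.2.map Prod.fst := by
      intro l
      by_cases hl : l ∈ p.support
      · obtain ⟨l', h1, h2⟩ := hp l hl
        obtain ⟨m₁, m₂, h, i', i, hm⟩ := exists_split_of_perm hs h1 h2
        exact ⟨((m₁, h, m₂), i', i), fun _ => hm⟩
      · exact ⟨(([], t₀, []), Classical.arbitrary I, Classical.arbitrary I),
          fun h => absurd h hl⟩
    choose q hq using hsplit
    let E : D → List (J × I) → List (J × I) →₀ F := fun x l =>
      (b.repr (b (q l).2.1 * x * b (q l).2.2)).mapDomain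
        fun k => (q l).1.1 ++ ((q l).1.2.1, k) :: (q l).1.2.2
    have hE : ∀ x, ∑ l ∈ p.support, p l • E x l = 0 := by
      intro x
      refine ih (hs.sublist (by simp)) _ (fun w hw => ?_) fun v => ?_
      · obtain ⟨l, hl, hw⟩ := Finsupp.mem_support_finsetSum _ hw
        have hw := Finsupp.mapDomain_support (Finsupp.support_smul hw)
        obtain ⟨k, -, rfl⟩ := Finset.mem_image.mp hw
        obtain ⟨l', h1, h2⟩ := hp l hl
        rw [(hq l hl).1] at h1
        simp only [List.map_append, List.map_cons] at h1 ⊢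
        exact perm_of_split h1 h2
      · rw [map_sum, ← h (Function.update v j x), Finsupp.linearCombination_apply, Finsupp.sum]
        refine Finset.sum_congr rfl fun l hl => ?_
        obtain ⟨h1, h2, h3, h4⟩ := hq l hl
        rw [map_smul, linearCombination_wordEval_mapDomain b v j x _ _ _ _ _ h2 h3 h4, ← h1]
    by_contra hne
    obtain ⟨w, hw⟩ := Finsupp.support_nonempty_iff.mpr hne
    set L := p.support.filter fun l => (q l).1 = (q w).1 with hL
    set I₀ := p.support.biUnion fun l => (l.map Prod.snd).toFinset with hI₀
    have hI₀_notMem : ∀ k ∉ I₀, ∀ l ∈ p.support,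
        k ∉ (q l).1.1.map Prod.snd ∧ k ∉ (q l).1.2.2.map Prod.snd := by
      intro k hk l hl
      have : k ∉ l.map Prod.snd := fun hkl =>
        hk (Finset.mem_biUnion.mpr ⟨l, hl, List.mem_toFinset.mpr hkl⟩)
      rw [(hq l hl).1] at this
      simp only [List.map_append, List.map_cons, List.mem_append, List.mem_cons, not_or] at this
      exact ⟨this.1, this.2.2.2⟩
    have hspan : ∀ x, ∑ l ∈ L, p l • (b (q l).2.1 * x * b (q l).2.2) ∈
        Submodule.span F (b '' I₀) := by
      intro x
      rw [b.mem_span_image]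
      intro k hk
      by_contra hkI
      refine Finsupp.mem_support_iff.mp hk ?_
      have h0 := DFunLike.congr_fun (hE x) ((q w).1.1 ++ ((q w).1.2.1, k) :: (q w).1.2.2)
      rw [Finsupp.finsetSum_apply, Finsupp.zero_apply] at h0
      rw [map_sum, Finsupp.finsetSum_apply, hL, Finset.sum_filter]
      refine (Finset.sum_congr rfl fun l hl => ?_).trans h0
      split_ifs with hlw
      · simp only [E, map_smul, Finsupp.smul_apply, hlw]
        rw [Finsupp.mapDomain_apply (f := fun k => (q w).1.1 ++ ((q w).1.2.1, k) :: (q w).1.2.2)]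
        intro k k' e
        simpa using e
      · simp only [E, Finsupp.smul_apply]
        rw [Finsupp.mapDomain_of_notMem_range, smul_zero]
        rintro ⟨k', e⟩
        obtain ⟨h1, h2⟩ := hI₀_notMem k hkI l hl
        obtain ⟨h3, h4, h5⟩ := append_cons_inj_of_notMem (hI₀_notMem k hkI w hw).1 h1 h2 e
        exact hlw (Prod.ext h3 (Prod.ext h4 h5))
    have : FiniteDimensional F (Submodule.span F (b '' I₀)) :=
      FiniteDimensional.span_of_finite F (I₀.finite_toSet.image b)
    have hwL : w ∈ L := Finset.mem_filter.mpr ⟨hw, rfl⟩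
    have hzero := coeff_eq_zero_of_finite_rank hcen hD b.linearIndependent
      (L.image fun l => (q l).2.2)
      (fun i => ∑ l ∈ L with (q l).2.2 = i, p l • b (q l).2.1) _ (fun x => by
        convert hspan x using 1
        refine Eq.trans ?_ (Finset.sum_fiberwise_of_maps_to
          (fun l hl => Finset.mem_image_of_mem (fun l => (q l).2.2) hl) _)
        refine Finset.sum_congr rfl fun i _ => ?_
        rw [Finset.sum_mul, Finset.sum_mul]
        refine Finset.sum_congr rfl fun l hl => ?_
        rw [← (Finset.mem_filter.mp hl).2]
        simp) (q w).2.2 (Finset.mem_image_of_mem _ hwL)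
    refine Finsupp.mem_support_iff.mp hw (eq_zero_of_sum_smul_basis_eq_zero b _
      (fun l => (q l).2.1) ?_ p hzero w (Finset.mem_filter.mpr ⟨hwL, rfl⟩))
    intro l hl m hm e
    simp only [hL, Finset.coe_filter, Finset.mem_filter, Set.mem_ofPred_eq] at hl hm
    have : q l = q m :=
      Prod.ext (hl.1.2.trans hm.1.2.symm) (Prod.ext e (hl.2.trans hm.2.symm))
    rw [(hq l hl.1.1).1, (hq m hm.1.1).1, this]

end Words

section Polarization

variable {I J T : Type*} [DecidableEq T]

/-- The alternating sum over the subsets of `S`. -/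
def altSum (S : Finset T) (g : Finset T → D) : D :=
  ∑ R ∈ S.powerset, (-1) ^ (S.card + R.card) * g R

theorem altSum_insert {S : Finset T} {t : T} (ht : t ∉ S) (g : Finset T → D) :
    altSum (insert t S) g = altSum S (fun R => g (insert t R)) - altSum S g := by
  unfold altSum
  rw [Finset.sum_powerset_insert ht, sub_eq_neg_add, ← Finset.sum_neg_distrib]
  congr 1
  · refine Finset.sum_congr rfl fun R _ => ?_
    rw [Finset.card_insert_of_notMem ht]
    simp [pow_succ, add_right_comm _ 1]
  · refine Finset.sum_congr rfl fun R hR => ?_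
    rw [Finset.card_insert_of_notMem ht,
      Finset.card_insert_of_notMem fun h => ht (Finset.mem_powerset.mp hR h)]
    congr 1
    rw [show S.card + 1 + (R.card + 1) = S.card + R.card + 2 by ring, pow_add]
    simp

theorem altSum_ite {S : Finset T} {t : T} (ht : t ∈ S) (g : Finset T → D) :
    altSum S (fun R => if t ∈ R then g R else 0) = altSum S g + altSum (S.erase t) g := by
  obtain ⟨S, ht', rfl⟩ : ∃ S', t ∉ S' ∧ S = insert t S' :=
    ⟨S.erase t, Finset.notMem_erase t S, (Finset.insert_erase ht).symm⟩
  rw [altSum_insert ht', altSum_insert ht', Finset.erase_insert ht']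
  have : altSum S (fun R => if t ∈ R then g R else 0) = 0 :=
    Finset.sum_eq_zero fun R hR => by
      simp [show t ∉ R from fun h => ht' (Finset.mem_powerset.mp hR h)]
  simp [this]

theorem altSum_const {S : Finset T} (hS : S.Nonempty) (c : D) :
    altSum S (fun _ => c) = 0 := by
  obtain ⟨t, ht⟩ := hS
  rw [← Finset.insert_erase ht, altSum_insert (Finset.notMem_erase t S), sub_self]

variable [DecidableEq J]

/-- The point whose coordinate at `j` is the sum of the `x t`, `t ∈ S`, with `t` over `j`. -/
def sumOver (π : T → J) (x : T → D) (S : Finset T) (j : J) : D :=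
  ∑ t ∈ S with π t = j, x t

theorem altSum_wordEval_cons (b : I → D) (π : T → J) (x : T → D) (S : Finset T) (z : J × I)
    (l : List (J × I)) :
    altSum S (fun R => wordEval b (sumOver π x R) (z :: l)) =
      ∑ t ∈ S with π t = z.1, x t * b z.2 *
        (altSum S (fun R => wordEval b (sumOver π x R) l) +
          altSum (S.erase t) fun R => wordEval b (sumOver π x R) l) := by
  have h1 : ∀ t ∈ S.filter (π · = z.1), x t * b z.2 *
      (altSum S (fun R => wordEval b (sumOver π x R) l) +
        altSum (S.erase t) fun R => wordEval b (sumOver π x R) l) =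
      ∑ R ∈ S.powerset, (-1) ^ (S.card + R.card) *
        (if t ∈ R then x t * b z.2 * wordEval b (sumOver π x R) l else 0) := by
    intro t ht
    rw [← altSum_ite (Finset.mem_filter.mp ht).1, altSum, Finset.mul_sum]
    refine Finset.sum_congr rfl fun R _ => ?_
    rcases neg_one_pow_eq_or D (S.card + R.card) with h | h <;> rw [h] <;> split_ifs <;> simp
  rw [Finset.sum_congr rfl h1, Finset.sum_comm]
  refine Finset.sum_congr rfl fun R hR => ?_
  rw [← Finset.mul_sum]
  beta_reduce
  rw [wordEval_cons]
  nth_rw 1 [sumOver]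
  rw [← Finset.sum_filter, Finset.sum_mul, Finset.sum_mul]
  congr 1
  refine Finset.sum_congr ?_ fun _ _ => rfl
  ext t
  simp only [Finset.mem_filter]
  exact ⟨fun h => ⟨⟨Finset.mem_powerset.mp hR h.1, h.2⟩, h.1⟩, fun h => ⟨h.2, h.1.2⟩⟩

theorem altSum_wordEval_eq_zero (b : I → D) (π : T → J) (x : T → D) (S : Finset T)
    (l : List (J × I)) (hl : l.length < S.card) :
    altSum S (fun R => wordEval b (sumOver π x R) l) = 0 := by
  induction l generalizing S with
  | nil => exact altSum_const (Finset.card_pos.mp hl) 1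
  | cons z l ih =>
    rw [List.length_cons] at hl
    rw [altSum_wordEval_cons]
    refine Finset.sum_eq_zero fun t ht => ?_
    rw [ih S (by lia), ih (S.erase t), add_zero, mul_zero]
    rw [Finset.card_erase_of_mem (Finset.mem_filter.mp ht).1]
    lia

variable (F) in
/-- The sum of the words over `T` lifting the word `l` along `π` and containing each element
of `S` exactly once. -/
noncomputable def multilinearPart (π : T → J) : Finset T → List (J × I) → List (T × I) →₀ F
  | S, [] => if S = ∅ then Finsupp.single [] 1 else 0
  | S, z :: l => ∑ t ∈ S with π t = z.1,
      (multilinearPart π (S.erase t) l).mapDomain (List.cons (t, z.2))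

theorem linearCombination_multilinearPart (b : I → D) (π : T → J) (x : T → D) (S : Finset T)
    (l : List (J × I)) (hl : l.length ≤ S.card) :
    Finsupp.linearCombination F (wordEval b x) (multilinearPart F π S l) =
      altSum S fun R => wordEval b (sumOver π x R) l := by
  induction l generalizing S with
  | nil =>
    rcases S.eq_empty_or_nonempty with rfl | hS
    · simp [multilinearPart, altSum, wordEval_nil]
    · rw [multilinearPart, if_neg hS.ne_empty, map_zero]
      exact (altSum_const hS 1).symm
  | cons z l ih =>
    rw [List.length_cons] at hl
    rw [altSum_wordEval_cons, multilinearPart, map_sum]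
    refine Finset.sum_congr rfl fun t ht => ?_
    rw [altSum_wordEval_eq_zero b π x S l (by lia), zero_add, ← ih,
      Finsupp.linearCombination_mapDomain]
    · have : wordEval b x ∘ List.cons (t, z.2) =
          LinearMap.mulLeft F (x t * b z.2) ∘ wordEval b x := by
        ext m
        simp [wordEval_cons, mul_assoc]
      rw [this, ← Finsupp.apply_linearCombination, LinearMap.mulLeft_apply]
    · rw [Finset.card_erase_of_mem (Finset.mem_filter.mp ht).1]
      lia

theorem multilinearPart_apply [DecidableEq I] (π : T → J) (S : Finset T) (l : List (J × I))
    (m : List (T × I)) :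
    multilinearPart F π S l m =
      if m.map (Prod.map π id) = l ∧ ((m.map Prod.fst : List T) : Multiset T) = S.val
      then 1 else 0 := by
  induction l generalizing S m with
  | nil =>
    rw [multilinearPart]
    by_cases hS : S = ∅
    · subst hS
      cases m <;> simp
    · rw [if_neg hS, Finsupp.zero_apply, if_neg]
      rintro ⟨h1, h2⟩
      rw [List.map_eq_nil_iff] at h1
      subst h1
      exact hS (Finset.val_eq_zero.mp h2.symm)
  | cons z l ih =>
    rw [multilinearPart, Finsupp.finsetSum_apply]
    cases m with
    | nil =>
      rw [if_neg (by simp)]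
      refine Finset.sum_eq_zero fun t _ => Finsupp.mapDomain_of_notMem_range _ _ ?_
      simp
    | cons y m =>
      have key : ∀ t, (multilinearPart F π (S.erase t) l).mapDomain (List.cons (t, z.2))
          (y :: m) = if t = y.1 then
            (if z.2 = y.2 then multilinearPart F π (S.erase t) l m else 0) else 0 := by
        intro t
        by_cases h : (t, z.2) = y
        · subst h
          rw [Finsupp.mapDomain_apply List.cons_injective]
          simp
        · rw [Finsupp.mapDomain_of_notMem_range]
          · split_ifs with h1 h2
            · exact absurd (Prod.ext h1 h2) h
            all_goals rfl
          · rintro ⟨m', hm'⟩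
            exact h (List.cons.inj hm').1
      simp only [key]
      rw [Finset.sum_ite_eq']
      simp only [ih]
      have hms : ((List.map Prod.fst (y :: m) : List T) : Multiset T) = S.val ↔
          y.1 ∈ S ∧ ((m.map Prod.fst : List T) : Multiset T) = (S.erase y.1).val := by
        rw [List.map_cons, ← Multiset.cons_coe, Finset.erase_val]
        constructor
        · intro h
          refine ⟨Finset.mem_def.mpr (h ▸ Multiset.mem_cons_self _ _), ?_⟩
          rw [← h, Multiset.erase_cons_head]
        · rintro ⟨h1, h2⟩
          rw [h2, Multiset.cons_erase h1]
      simp only [hms]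
      simp only [List.map_cons, List.cons.injEq, Finset.mem_filter, Prod.ext_iff, Prod.map_fst,
        Prod.map_snd, id]
      split_ifs <;> grind

theorem eq_zero_of_linearCombination_wordEval_eq_zero
    (hcen : Set.range (algebraMap F D) = (Subring.center D : Set D))
    (hD : ¬ FiniteDimensional F D) (b : Module.Basis I F D) (j₀ : J) (p : List (J × I) →₀ F)
    (hp : ∀ l ∈ p.support, ∃ l', l.map Prod.fst = j₀ :: l' ∧ j₀ ∉ l')
    (h : ∀ v : J → D, Finsupp.linearCombination F (wordEval b v) p = 0) : p = 0 := by
  classical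
  by_contra hne
  obtain ⟨w, hw, hmax⟩ := Finset.exists_max_image p.support List.length
    (Finsupp.support_nonempty_iff.mpr hne)
  obtain ⟨w', hw', hj₀⟩ := hp w hw
  let π : Fin w.length → J := fun t => (w.get t).1
  have hπ : List.ofFn π = j₀ :: w' := by
    rw [← hw']
    conv_rhs => rw [← List.ofFn_get w, List.map_ofFn]
    rfl
  have hpos : 0 < w.length := by
    rw [← List.length_map (f := Prod.fst), hw']
    simp
  let t₀ : Fin w.length := ⟨0, hpos⟩
  have hπ₀ : ∀ t, π t = j₀ → t = t₀ := by
    rintro ⟨t, ht⟩ h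
    rcases t with _ | t
    · rfl
    · exfalso
      apply hj₀
      have : (List.ofFn π)[t + 1]? = some j₀ := by
        rw [List.getElem?_ofFn, dif_pos ht, h]
      rw [hπ, List.getElem?_cons_succ] at this
      exact List.mem_of_getElem? this
  let Q : List (Fin w.length × I) →₀ F :=
    ∑ l ∈ p.support, p l • multilinearPart F π Finset.univ l
  have hQ : Q = 0 := by
    refine eq_zero_of_multilinear hcen hD b t₀ (Finset.univ.erase t₀).toList ?_ Q ?_ ?_
    · simp [Finset.nodup_toList]
    · intro m hm
      obtain ⟨l, hl, hm⟩ := Finsupp.mem_support_finsetSum _ hm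
      have hm := Finsupp.mem_support_iff.mp (Finsupp.support_smul hm)
      rw [multilinearPart_apply] at hm
      obtain ⟨h1, h2⟩ := of_not_not fun h => hm (if_neg h)
      obtain ⟨l', h3, -⟩ := hp l hl
      rw [← h1] at h3
      cases m with
      | nil => simp at h3
      | cons y m =>
        simp only [List.map_cons, Prod.map_fst, List.cons.injEq] at h3
        have hy := hπ₀ _ h3.1
        refine ⟨m.map Prod.fst, by rw [List.map_cons, hy], ?_⟩
        rw [← Multiset.coe_eq_coe, Finset.coe_toList, Finset.erase_val, ← h2, List.map_cons, hy,
          ← Multiset.cons_coe, Multiset.erase_cons_head]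
    · intro x
      have : ∀ l ∈ p.support, Finsupp.linearCombination F (wordEval b x)
          (p l • multilinearPart F π Finset.univ l) =
          ∑ R ∈ Finset.univ.powerset, (-1) ^ ((Finset.univ : Finset (Fin w.length)).card + R.card) *
            (p l • wordEval b (sumOver π x R) l) := by
        intro l hl
        rw [map_smul, linearCombination_multilinearPart _ _ _ _ _ (by simpa using hmax l hl),
          altSum, Finset.smul_sum]
        simp only [mul_smul_comm]
      rw [map_sum, Finset.sum_congr rfl this, Finset.sum_comm]
      refine Finset.sum_eq_zero fun R _ => ?_
      rw [← Finset.mul_sum]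
      have := h (sumOver π x R)
      rw [Finsupp.linearCombination_apply, Finsupp.sum] at this
      rw [this, mul_zero]
  let w₁ : List (Fin w.length × I) := List.ofFn fun t => (t, (w.get t).2)
  have hw₁ : w₁.map (Prod.map π id) = w := by
    conv_rhs => rw [← List.ofFn_get w]
    rw [List.map_ofFn]
    rfl
  have hw₁' : ((w₁.map Prod.fst : List _) : Multiset (Fin w.length)) = Finset.univ.val := by
    rw [List.map_ofFn]
    exact congrArg _ (List.ofFn_id _)
  have hQw : Q w₁ = p w := by
    simp only [Q, Finsupp.finsetSum_apply, Finsupp.smul_apply, multilinearPart_apply, hw₁, hw₁',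
      and_true, smul_eq_mul, mul_ite, mul_one, mul_zero]
    rw [Finset.sum_ite_eq, if_pos hw]
  rw [hQ] at hQw
  exact Finsupp.mem_support_iff.mp hw hQw.symm

end Polarization

section GeneralizedPolynomials

open scoped TensorProduct

@[simp]
theorem GP.lift_X_s6 {ι A : Type*} [Semiring A] [Algebra F A] (φ : D →ₐ[F] A) (v : ι → A) (i : ι) :
    GP.lift φ v (GP.X i : GP F D ι) = v i := by
  unfold GP.lift GP.X
  erw [RingQuot.liftAlgHom_mkAlgHom_apply]
  simp

@[simp]
theorem GP.lift_C_s6 {ι A : Type*} [Semiring A] [Algebra F A] (φ : D →ₐ[F] A) (v : ι → A) (d : D) :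
    GP.lift φ v (GP.C d : GP F D ι) = φ d := by
  unfold GP.lift
  change RingQuot.liftAlgHom F _ (RingQuot.mkAlgHom F (GPRel F D ι) _) = _
  erw [RingQuot.liftAlgHom_mkAlgHom_apply]
  simp

/-- The quotient map onto `D⟨ι⟩`. -/
noncomputable def GP.mk (ι : Type*) : FreeAlgebra F (D ⊕ ι) →ₐ[F] GP F D ι :=
  RingQuot.mkAlgHom F (GPRel F D ι)

/-- A subspace of `D⟨ι⟩` containing `1` and stable under left multiplication by the generators
is everything. -/
theorem GP.eq_top_of_mul_mem {ι : Type*} (N : Submodule F (GP F D ι)) (h1 : 1 ∈ N)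
    (hC : ∀ d : D, ∀ g ∈ N, GP.C d * g ∈ N) (hX : ∀ i, ∀ g ∈ N, GP.X i * g ∈ N) : N = ⊤ := by
  rw [eq_top_iff]
  rintro f -
  obtain ⟨a, rfl⟩ : ∃ a, GP.mk ι a = f := RingQuot.mkAlgHom_surjective F (GPRel F D ι) f
  suffices ∀ g ∈ N, GP.mk ι a * g ∈ N by
    have h := this 1 h1
    rwa [mul_one] at h
  induction a using FreeAlgebra.induction with
  | grade0 r =>
    intro g hg
    rw [AlgHom.commutes, ← Algebra.smul_def]
    exact N.smul_mem _ hg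
  | grade1 x =>
    rcases x with d | i
    · exact hC d
    · exact hX i
  | mul a a' ha ha' =>
    intro g hg
    rw [map_mul, mul_assoc]
    exact ha _ (ha' g hg)
  | add a a' ha ha' =>
    intro g hg
    rw [map_add, add_mul]
    exact N.add_mem (ha g hg) (ha' g hg)

theorem GP.lift_X_injective (ι : Type*) :
    Function.Injective (FreeAlgebra.lift F (GP.X : ι → GP F D ι)) := by
  let φ : GP F D ι →ₐ[F] D ⊗[F] FreeAlgebra F ι :=
    GP.lift Algebra.TensorProduct.includeLeft
      fun i => Algebra.TensorProduct.includeRight (FreeAlgebra.ι F i)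
  have h : φ.comp (FreeAlgebra.lift F GP.X) = Algebra.TensorProduct.includeRight := by
    ext i
    simp [φ]
  have hinj : Function.Injective
      (Algebra.TensorProduct.includeRight : FreeAlgebra F ι →ₐ[F] D ⊗[F] FreeAlgebra F ι) :=
    Algebra.TensorProduct.includeRight_injective (algebraMap F D).injective
  rw [← h] at hinj
  exact Function.Injective.of_comp hinj

theorem GP.eval_lift_X {ι : Type*} (v : ι → D) (f : FreeAlgebra F ι) :
    GP.eval v (FreeAlgebra.lift F (GP.X : ι → GP F D ι) f) = FreeAlgebra.lift F v f := by
  have : (GP.eval v).comp (FreeAlgebra.lift F (GP.X : ι → GP F D ι)) = FreeAlgebra.lift F v := by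
    ext i
    simp [GP.eval]
  exact DFunLike.congr_fun this f

variable {I ι : Type*}

/-- The generalized monomial `b_{i₀} X_{j₁} b_{i₁} X_{j₂} b_{i₂} ⋯`. -/
noncomputable def GP.monomial_s6 (b : I → D) (z : I × List (ι × I)) : GP F D ι :=
  GP.C (b z.1) * (z.2.map fun y => GP.X y.1 * GP.C (b y.2)).prod

theorem GP.span_monomial (b : Module.Basis I F D) :
    Submodule.span F (Set.range (GP.monomial_s6 b : I × List (ι × I) → GP F D ι)) = ⊤ := by
  set N := Submodule.span F (Set.range (GP.monomial_s6 b : I × List (ι × I) → GP F D ι))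
  have hCprod : ∀ (l : List (ι × I)) (d : D),
      GP.C d * (l.map fun y => GP.X y.1 * GP.C (b y.2)).prod ∈ N := by
    intro l d
    have := Submodule.mem_top (R := F) (x := d)
    rw [← b.span_eq] at this
    induction this using Submodule.span_induction with
    | mem d hd =>
      obtain ⟨i, rfl⟩ := hd
      exact Submodule.subset_span ⟨(i, l), rfl⟩
    | zero => simp
    | add d d' _ _ h h' => rw [map_add, add_mul]; exact N.add_mem h h'
    | smul r d _ h => rw [map_smul, smul_mul_assoc]; exact N.smul_mem r h
  have hleft : ∀ a : GP F D ι, (∀ z, a * GP.monomial_s6 b z ∈ N) → ∀ g ∈ N, a * g ∈ N := by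
    intro a ha g hg
    induction hg using Submodule.span_induction with
    | mem g hg => obtain ⟨z, rfl⟩ := hg; exact ha z
    | zero => simp
    | add g g' _ _ h h' => rw [mul_add]; exact N.add_mem h h'
    | smul r g _ h => rw [mul_smul_comm]; exact N.smul_mem r h
  refine GP.eq_top_of_mul_mem N ?_ (fun d => hleft _ fun z => ?_) fun j => hleft _ fun z => ?_
  · simpa using hCprod [] 1
  · rw [GP.monomial_s6, ← mul_assoc, ← map_mul]
    exact hCprod _ _
  · have := hCprod ((j, z.1) :: z.2) 1
    rwa [map_one, one_mul, List.map_cons, List.prod_cons, mul_assoc] at this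

theorem GP.eval_monomial (b : I → D) (v : ι → D) (z : I × List (ι × I)) :
    GP.eval v (GP.monomial_s6 b z : GP F D ι) = b z.1 * wordEval b v z.2 := by
  simp [GP.monomial_s6, GP.eval, wordEval, map_list_prod, Function.comp_def]

theorem GP.eq_zero_of_eval_eq_zero
    (hcen : Set.range (algebraMap F D) = (Subring.center D : Set D))
    (hD : ¬ FiniteDimensional F D) (f : GP F D ι) (hf : ∀ v : ι → D, GP.eval v f = 0) :
    f = 0 := by
  classical
  obtain ⟨⟨I, b⟩⟩ := Module.Free.exists_basis F D
  have hmem : f ∈ Submodule.span F (Set.range (GP.monomial_s6 b)) := by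
    rw [GP.span_monomial]
    trivial
  obtain ⟨p, rfl⟩ := Finsupp.mem_span_range_iff_exists_finsupp.mp hmem
  let e : I × List (ι × I) → List (Option ι × I) :=
    fun z => (none, z.1) :: z.2.map (Prod.map some id)
  have he : Function.Injective e := by
    rintro ⟨i, l⟩ ⟨i', l'⟩ h
    simp only [e, List.cons.injEq, Prod.mk.injEq, true_and] at h
    exact Prod.ext h.1 (List.map_injective_iff.mpr
      (Function.Injective.prodMap (Option.some_injective _) Function.injective_id) h.2)
  have hp : p.mapDomain e = 0 := by
    refine eq_zero_of_linearCombination_wordEval_eq_zero hcen hD b none _ (fun l hl => ?_)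
      fun v => ?_
    · obtain ⟨z, -, rfl⟩ := Finset.mem_image.mp (Finsupp.mapDomain_support hl)
      refine ⟨_, rfl, ?_⟩
      simp
    · have := congrArg (v none * ·) (hf fun j => v (some j))
      rw [Finsupp.sum, map_sum, Finset.mul_sum, mul_zero] at this
      rw [Finsupp.linearCombination_mapDomain, Finsupp.linearCombination_apply, Finsupp.sum,
        ← this]
      refine Finset.sum_congr rfl fun z _ => ?_
      rw [map_smul, GP.eval_monomial, mul_smul_comm]
      simp [e, wordEval, Function.comp_def, mul_assoc]
  rw [Finsupp.mapDomain_injective he (hp.trans Finsupp.mapDomain_zero.symm), Finsupp.sum_zero_index]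

end GeneralizedPolynomials

section StandardPolynomial

variable (F)

/-- The standard polynomial of degree `n`. -/
noncomputable def standardPolynomial (n : ℕ) : FreeAlgebra F (Fin n) :=
  MultilinearMap.alternatization (MultilinearMap.mkPiAlgebraFin F n (FreeAlgebra F (Fin n)))
    (FreeAlgebra.ι F)

theorem lift_standardPolynomial {A : Type*} [Ring A] [Algebra F A] {n : ℕ} (v : Fin n → A) :
    FreeAlgebra.lift F v (standardPolynomial F n) =
      MultilinearMap.alternatization (MultilinearMap.mkPiAlgebraFin F n A) v := by
  simp [standardPolynomial, MultilinearMap.alternatization_apply, map_list_prod,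
    List.map_ofFn, Function.comp_def, Units.smul_def]

theorem standardPolynomial_ne_zero (n : ℕ) : standardPolynomial F n ≠ 0 := by
  intro h
  have h := congrArg (FreeAlgebra.lift F
    fun i => MonoidAlgebra.of F (FreeMonoid (Fin n)) (FreeMonoid.of i)) h
  rw [lift_standardPolynomial, map_zero, MultilinearMap.alternatization_apply] at h
  have hlist : ∀ l : List (Fin n),
      (l.map fun i => MonoidAlgebra.of F (FreeMonoid (Fin n)) (FreeMonoid.of i)).prod =
        MonoidAlgebra.single (FreeMonoid.ofList l) 1 := by
    intro l
    induction l with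
    | nil => rfl
    | cons i l ih =>
      rw [List.map_cons, List.prod_cons, ih, MonoidAlgebra.of_apply,
        MonoidAlgebra.single_mul_single, one_mul, FreeMonoid.ofList_cons]
  have key : ∀ σ : Equiv.Perm (Fin n), (MultilinearMap.mkPiAlgebraFin F n
      (MonoidAlgebra F (FreeMonoid (Fin n)))).domDomCongr σ
        (fun i => MonoidAlgebra.of F (FreeMonoid (Fin n)) (FreeMonoid.of i)) =
      MonoidAlgebra.single (FreeMonoid.ofList (List.ofFn σ)) 1 := by
    intro σ
    rw [← hlist, MultilinearMap.domDomCongr_apply, MultilinearMap.mkPiAlgebraFin_apply,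
      List.map_ofFn]
    rfl
  simp only [key] at h
  have h := congrArg (fun f : MonoidAlgebra F (FreeMonoid (Fin n)) =>
    f.coeff (FreeMonoid.ofList (List.ofFn (1 : Equiv.Perm (Fin n))))) h
  simp only [MonoidAlgebra.coeff_sum, Finsupp.finsetSum_apply, Units.smul_def,
    MonoidAlgebra.coeff_smul_apply, MonoidAlgebra.coeff_zero, Finsupp.coe_zero,
    Pi.zero_apply] at h
  rw [Finset.sum_eq_single 1 (fun σ _ hσ => ?_) (fun h1 => absurd (Finset.mem_univ _) h1)] at h
  · simp at h
  · rw [MonoidAlgebra.coeff_single, Finsupp.single_eq_of_ne' fun he => hσ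
      (DFunLike.coe_injective (List.ofFn_injective (FreeMonoid.ofList.injective he))), smul_zero]

end StandardPolynomial

/-- Let `D` be a division ring with center `F`, and suppose `F`
is infinite.  Then the following are equivalent: (1) `D` is centrally finite;
(2) `D` satisfies a polynomial identity (a nonzero element of the free algebra
`F⟨x₁,…,xₙ⟩` vanishing under all evaluations in `D`); (3) `D` satisfies a
generalized polynomial identity (a nonzero element of `D⟨x₁,…,xₙ⟩` vanishing
under all evaluations in `D`). -/
theorem stmt6 {D : Type*} [DivisionRing D] (F : Type*) [Field F] [Algebra F D]
    (hcen : Set.range (algebraMap F D) = (Subring.center D : Set D))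
    (hFinf : Infinite F) :
    (FiniteDimensional F D ↔
      ∃ (n : ℕ) (f : FreeAlgebra F (Fin n)), f ≠ 0 ∧
        ∀ v : Fin n → D, FreeAlgebra.lift F v f = 0) ∧
    (FiniteDimensional F D ↔
      ∃ (n : ℕ) (f : GP F D (Fin n)), f ≠ 0 ∧
        ∀ v : Fin n → D, GP.eval v f = 0) := by
  have h12 : FiniteDimensional F D → ∃ (n : ℕ) (f : FreeAlgebra F (Fin n)), f ≠ 0 ∧
      ∀ v : Fin n → D, FreeAlgebra.lift F v f = 0 := fun _ =>
    ⟨Module.finrank F D + 1, standardPolynomial F _, standardPolynomial_ne_zero F _, fun v => by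
      rw [lift_standardPolynomial]
      refine AlternatingMap.map_linearDependent _ _ fun hv => ?_
      simpa using hv.fintype_card_le_finrank⟩
  have h23 : (∃ (n : ℕ) (f : FreeAlgebra F (Fin n)), f ≠ 0 ∧
      ∀ v : Fin n → D, FreeAlgebra.lift F v f = 0) →
      ∃ (n : ℕ) (f : GP F D (Fin n)), f ≠ 0 ∧ ∀ v : Fin n → D, GP.eval v f = 0 := by
    rintro ⟨n, f, hf, h⟩
    exact ⟨n, FreeAlgebra.lift F GP.X f,
      (map_ne_zero_iff _ (GP.lift_X_injective (Fin n))).mpr hf,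
      fun v => by rw [GP.eval_lift_X, h]⟩
  have h31 : (∃ (n : ℕ) (f : GP F D (Fin n)), f ≠ 0 ∧ ∀ v : Fin n → D, GP.eval v f = 0) →
      FiniteDimensional F D := by
    rintro ⟨n, f, hf, h⟩
    by_contra hD
    exact hf (GP.eq_zero_of_eval_eq_zero hcen hD f h)
  exact ⟨⟨h12, h31 ∘ h23⟩, h23 ∘ h12, h31⟩
end

section
/- Let D be a division ring with infinite center F, and suppose D is not centrally finite. Let a_1,…,a_n ∈ D be linearly independent over F, and let c ∈ D be nonzero. Then there exists an element r ∈ D such that the 2n elements a_1,…,a_n, c r a_1, c r a_2, …, c r a_n are linearly independent over F. -/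
open Module in
/-- For a linearly independent family `u` and any family `w`, some nonzero member of the pencil
`μ • u + w` is linearly independent. -/
theorem LinearIndependent.exists_ne_zero_smul_add {F W ι : Type*} [Field F] [Infinite F]
    [AddCommGroup W] [Module F W] [Fintype ι] {u : ι → W} (hu : LinearIndependent F u)
    (w : ι → W) : ∃ μ : F, μ ≠ 0 ∧ LinearIndependent F fun i => μ • u i + w i := by
  classical
  obtain ⟨φ, hφ⟩ := (Fintype.linearCombination F u).exists_leftInverse_of_injective
    (LinearMap.ker_eq_bot.2 hu.fintypeLinearCombination_injective)
  set B : End F (ι → F) := φ ∘ₗ Fintype.linearCombination F w with hB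
  obtain ⟨μ, hμ⟩ := ((End.finite_hasEigenvalue (-B)).union (Set.finite_singleton 0)).exists_notMem
  rw [Set.mem_union, not_or] at hμ
  refine ⟨μ, hμ.2, ?_⟩
  rw [Fintype.linearIndependent_iff]
  intro x hx
  suffices x = 0 from congrFun this
  by_contra hx0
  refine hμ.1 (End.hasEigenvalue_of_hasEigenvector (x := x) ⟨End.mem_eigenspace_iff.2 ?_, hx0⟩)
  have hsum : μ • Fintype.linearCombination F u x + Fintype.linearCombination F w x = 0 := by
    rw [← hx]
    simp only [Fintype.linearCombination_apply, Finset.smul_sum, smul_add, Finset.sum_add_distrib]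
    simp only [smul_comm μ]
  have hid : φ (Fintype.linearCombination F u x) = x := LinearMap.congr_fun hφ x
  have := congrArg φ hsum
  rw [map_add, map_smul, hid, map_zero] at this
  rw [LinearMap.neg_apply, hB, LinearMap.comp_apply]
  exact (eq_neg_of_add_eq_zero_left this).symm

/-- **Amitsur's lemma**: if every nontrivial linear combination of finitely many linear maps over
an infinite field has infinite rank, then the maps take linearly independent values at some
vector. -/
theorem LinearMap.exists_linearIndependent_apply {F U W : Type*} [Field F] [Infinite F]
    [AddCommGroup U] [Module F U] [AddCommGroup W] [Module F W] {n : ℕ} (f : Fin n → U →ₗ[F] W)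
    (hf : ∀ c : Fin n → F, c ≠ 0 → ¬ FiniteDimensional F (LinearMap.range (∑ i, c i • f i))) :
    ∃ x : U, LinearIndependent F fun i => f i x := by
  induction n with
  | zero => exact ⟨0, linearIndependent_empty_type⟩
  | succ n ih =>
    obtain ⟨x, hx⟩ := ih (fun i => f i.succ) fun c hc => by
      have := hf (Fin.cons 0 c) fun h => hc (by
        ext i
        simpa using congrFun h i.succ)
      have hsum : ∑ i, (Fin.cons 0 c : Fin (n + 1) → F) i • f i = ∑ i, c i • f i.succ := by
        simp [Fin.sum_univ_succ]
      rwa [hsum] at this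
    by_cases h0 : f 0 x ∈ Submodule.span F (Set.range fun i : Fin n => f i.succ x)
    swap
    · exact ⟨x, linearIndependent_finSucc.2 ⟨hx, h0⟩⟩
    obtain ⟨c, hc⟩ := (Submodule.mem_span_range_iff_exists_fun F).1 h0
    set g : U →ₗ[F] W := f 0 - ∑ i, c i • f i.succ with hg
    have hgx : g x = 0 := by simp [hg, hc]
    have hgrange : ¬ FiniteDimensional F (LinearMap.range g) := by
      have := hf (Fin.cons 1 (-c)) fun h => one_ne_zero (α := F) (by simpa using congrFun h 0)
      have hsum : ∑ i, (Fin.cons 1 (-c) : Fin (n + 1) → F) i • f i = g := by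
        simp [Fin.sum_univ_succ, hg, sub_eq_add_neg]
      rwa [hsum] at this
    obtain ⟨y, hy⟩ : ∃ y, g y ∉ Submodule.span F (Set.range fun i : Fin n => f i.succ x) := by
      by_contra! h
      have := FiniteDimensional.span_of_finite F (Set.finite_range fun i : Fin n => f i.succ x)
      exact hgrange (Submodule.finiteDimensional_of_le (LinearMap.range_le_iff_comap.2
        (Submodule.eq_top_iff'.2 fun y => Submodule.mem_comap.2 (h y))))
    obtain ⟨μ, hμ, hli⟩ := (linearIndependent_finCons.2 ⟨hx, hy⟩).exists_ne_zero_smul_add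
      (Fin.cons 0 fun i => f i.succ y)
    rw [linearIndependent_finSucc] at hli
    obtain ⟨htail, hhead⟩ := hli
    have htail_eq : (Fin.tail fun i : Fin (n + 1) =>
        μ • (Fin.cons (g y) fun i : Fin n => f i.succ x : Fin (n + 1) → W) i +
          (Fin.cons 0 fun i : Fin n => f i.succ y : Fin (n + 1) → W) i) =
        fun i : Fin n => f i.succ (μ • x + y) := by
      ext i
      simp [Fin.tail]
    rw [htail_eq] at htail hhead
    refine ⟨μ • x + y, linearIndependent_finSucc.2 ⟨htail, fun hmem => hhead ?_⟩⟩
    have hgy : g y = f 0 (μ • x + y) - ∑ i, c i • f i.succ (μ • x + y) := by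
      rw [← zero_add (g y), ← smul_zero μ, ← hgx, ← map_smul, ← map_add]
      simp [hg]
    simp only [Fin.cons_zero, add_zero]
    rw [hgy]
    exact Submodule.smul_mem _ _ (Submodule.sub_mem _ hmem (Submodule.sum_mem _ fun i _ =>
      Submodule.smul_mem _ _ (Submodule.subset_span ⟨i, rfl⟩)))

/-- Let `D` be a division ring with infinite center `F`, and
suppose `D` is not centrally finite.  Let `a₁, …, aₙ ∈ D` be linearly independent
over `F`, and let `c ∈ D` be nonzero.  Then there exists `r ∈ D` such that the
`2n` elements `a₁, …, aₙ, c r a₁, …, c r aₙ` are linearly independent over `F`. -/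
theorem stmt9 {D : Type*} [DivisionRing D] (F : Type*) [Field F] [Algebra F D]
    (hcen : Set.range (algebraMap F D) = (Subring.center D : Set D))
    (hFinf : Infinite F)
    (hD : ¬ FiniteDimensional F D)
    (n : ℕ) (a : Fin n → D) (ha : LinearIndependent F a)
    (c : D) (hc : c ≠ 0) :
    ∃ r : D, LinearIndependent F (Sum.elim a fun j : Fin n => c * r * a j) := by
  set V := Submodule.span F (Set.range a)
  have hVfin : FiniteDimensional F V := FiniteDimensional.span_of_finite F (Set.finite_range a)
  obtain ⟨x, hx⟩ := LinearMap.exists_linearIndependent_apply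
    (fun i => V.mkQ ∘ₗ LinearMap.mulRight F (a i)) fun k hk hfin => by
      have hb : ∑ i, k i • a i ≠ 0 := fun h =>
        hk (funext (Fintype.linearIndependent_iff.1 ha k h))
      have hcomb : ∑ i, k i • (V.mkQ ∘ₗ LinearMap.mulRight F (a i)) =
          V.mkQ ∘ₗ LinearMap.mulRight F (∑ i, k i • a i) := by
        ext y
        simp [Finset.mul_sum]
      have hsurj : Function.Surjective (LinearMap.mulRight F (∑ i, k i • a i)) := fun y =>
        ⟨y * (∑ i, k i • a i)⁻¹, by simp [hb]⟩
      rw [hcomb, LinearMap.range_comp, LinearMap.range_eq_top.2 hsurj, Submodule.map_top,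
        V.range_mkQ] at hfin
      have : Module.Finite F (D ⧸ V) := Module.Finite.equiv Submodule.topEquiv
      exact hD (Module.Finite.of_submodule_quotient V)
  refine ⟨c⁻¹ * x, ?_⟩
  simp only [mul_inv_cancel_left₀ hc]
  have haV : LinearIndependent F fun i => (⟨a i, Submodule.subset_span ⟨i, rfl⟩⟩ : V) :=
    linearIndependent_span ha
  exact haV.sumElim_of_quotient (fun j => x * a j) hx
end
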